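/- arXiv:1904.03073 — 3 statements merged into one kernel-verified Lean document; each statement's English description precedes it below -/
import Mathlib

section
/- Let a < 1. The function v_0(z) = (1 + z²)^{(a−2)/2} satisfies the ordinary differential equation (1 + z²) v''(z) − (a − 4) z v'(z) − (a − 2) v(z) = 0 for all z ∈ ℝ, and ∫_ℝ |v_0(z)|² (1 + z²)^{(2−a)/2} dz < ∞. Moreover, every twice continuously differentiable function v : ℝ → ℂ satisfying this ODE on all of ℝ together with ∫_ℝ |v(z)|² (1 + z²)^{(2−a)/2} dz < ∞ is a scalar multiple of v_0. -/
open MeasureTheory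

noncomputable section

lemma s_pos (z : ℝ) : (0:ℝ) < 1 + z^2 := by positivity

lemma hd_s (r z : ℝ) :
    HasDerivAt (fun z : ℝ => ((1 + z^2) ^ r : ℝ)) (2 * r * z * (1 + z^2) ^ (r-1)) z := by
  have h1 : HasDerivAt (fun z : ℝ => 1 + z^2) (2 * z) z := by
    simpa using (hasDerivAt_pow 2 z).const_add 1
  have := h1.rpow_const (p := r) (Or.inl (s_pos z).ne')
  convert this using 1
  ring

lemma rp_sub (r z : ℝ) : (1 + z^2) * ((1 + z^2) ^ (r-1) : ℝ) = (1 + z^2) ^ r := by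
  rw [Real.rpow_sub_one (s_pos z).ne']
  field_simp [(s_pos z).ne']

lemma part1 (a z : ℝ) : ((1 + z^2 : ℝ) : ℂ) *
          deriv (deriv (fun z : ℝ => (((1 + z^2) ^ ((a-2)/2) : ℝ) : ℂ))) z
        - (((a - 4) * z : ℝ) : ℂ) *
            deriv (fun z : ℝ => (((1 + z^2) ^ ((a-2)/2) : ℝ) : ℂ)) z
        - ((a - 2 : ℝ) : ℂ) * (((1 + z^2) ^ ((a-2)/2) : ℝ) : ℂ) = 0 := by
  have h1 : deriv (fun z : ℝ => (((1 + z^2) ^ ((a-2)/2) : ℝ) : ℂ)) =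
      fun z : ℝ => ((2 * ((a-2)/2) * z * (1 + z^2) ^ ((a-2)/2-1) : ℝ) : ℂ) := by
    funext z
    exact (hd_s _ z).ofReal_comp.deriv
  have h2 := ((((hasDerivAt_id z).const_mul (2 * ((a-2)/2))).mul
    (hd_s ((a-2)/2-1) z)).ofReal_comp).deriv
  simp only [id, Pi.mul_apply] at h2
  rw [h1, h2]
  have e1 := rp_sub ((a-2)/2) z
  have e2 := rp_sub ((a-2)/2-1) z
  beta_reduce
  rw [← e1, ← e2]
  generalize ((1 + z^2) ^ ((a-2)/2-1-1) : ℝ) = X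
  push_cast
  ring

lemma part2 (a : ℝ) (ha : a < 1) : Integrable (fun z : ℝ =>
      ‖(((1 + z^2) ^ ((a-2)/2) : ℝ) : ℂ)‖^2 * ((1 + z^2) ^ ((2-a)/2) : ℝ)) := by
  have h := integrable_rpow_neg_one_add_norm_sq (E := ℝ) (μ := volume) (r := 2 - a)
    (by simp; linarith)
  refine h.congr (Filter.Eventually.of_forall fun z => ?_)
  have hs := s_pos z
  simp only [Complex.norm_real, Real.norm_eq_abs, sq_abs]
  rw [← Real.rpow_natCast ((1 + z^2) ^ ((a-2)/2)), ← Real.rpow_mul hs.le, ← Real.rpow_add hs]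
  congr 1
  push_cast
  ring

/-- Key: a function with derivative `C s^(p-1)` cannot be weighted-square integrable. -/
lemma key (p : ℝ) (hp : 1/2 < p) (w : ℝ → ℂ) (C : ℂ)
    (hw : ∀ z, HasDerivAt w (C * (((1 + z^2) ^ (p-1) : ℝ) : ℂ)) z)
    (hi : Integrable (fun z : ℝ => ‖w z‖^2 * ((1 + z^2) ^ (-p) : ℝ))) : C = 0 := by
  by_contra hC
  set k : ℝ := 1 / (1 + 2 * p) with hk
  have hkpos : 0 < k := by positivity
  have hCn : 0 < ‖C‖ := norm_pos_iff.mpr hC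
  -- lower bound
  have hlow : ∀ z : ℝ, 0 ≤ z →
      2 * k * (z * (1 + z^2) ^ (p-1)) ≤ ((w z - w (-z)) / C).re := by
    let g : ℝ → ℝ := fun z => ((w z - w (-z)) / C).re - 2 * k * (z * (1 + z^2) ^ (p-1))
    have hg : ∀ z, HasDerivAt g (2 * (1 + z^2) ^ (p-1) - 2 * k *
        (1 * (1 + z^2) ^ (p-1) + z * (2 * (p-1) * z * (1 + z^2) ^ (p-1-1)))) z := by
      intro z
      have hneg : HasDerivAt (fun z => w (-z)) (-(C * (((1 + z^2) ^ (p-1) : ℝ) : ℂ))) z := by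
        have := (hw (-z)).scomp z (hasDerivAt_neg z)
        simpa [Function.comp_def] using this
      have h1 := ((hw z).sub hneg).div_const C
      have h2 := Complex.reCLM.hasFDerivAt.comp_hasDerivAt z h1
      have h3 := ((hasDerivAt_id z).mul (hd_s (p-1) z)).const_mul (2 * k)
      have h4 := h2.sub h3
      refine h4.congr_deriv ?_
      have : (C * (((1 + z^2) ^ (p-1) : ℝ) : ℂ) - -(C * (((1 + z^2) ^ (p-1) : ℝ) : ℂ))) / C
          = ((2 * (1 + z^2) ^ (p-1) : ℝ) : ℂ) := by
        field_simp
        push_cast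
        ring
      rw [this]
      simp only [Complex.reCLM_apply, Complex.ofReal_re, id]
    have hmono : Monotone g := by
      refine monotone_of_deriv_nonneg (fun z => (hg z).differentiableAt) fun z => ?_
      rw [(hg z).deriv]
      have e := rp_sub (p-1) z
      have hx : 0 < ((1 + z^2) ^ (p-1-1) : ℝ) := Real.rpow_pos_of_pos (s_pos z) _
      rw [← e]
      have hk1 : k * (1 + 2 * p) = 1 := by rw [hk]; field_simp
      have : 2 * ((1 + z ^ 2) * (1 + z ^ 2) ^ (p - 1 - 1)) -
          2 * k * (1 * ((1 + z ^ 2) * (1 + z ^ 2) ^ (p - 1 - 1)) +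
          z * (2 * (p - 1) * z * (1 + z ^ 2) ^ (p - 1 - 1)))
          = 2 * ((1 + z ^ 2) ^ (p - 1 - 1)) * (k * (2 * p + 2 * z^2)) +
           2 * ((1 + z ^ 2) ^ (p - 1 - 1)) * (1 + z^2) * (1 - k * (1 + 2*p)) := by ring
      rw [this, hk1]
      simp only [sub_self, mul_zero, add_zero]
      positivity
    intro z hz
    have := hmono hz
    simp only [g] at this
    simp at this
    simpa using this
  have hi2 := hi.comp_neg
  have hsum := hi.add hi2
  have hbig : IntegrableOn (fun z : ℝ => (‖C‖^2 * k^2 / 4) * z⁻¹) (Set.Ioi 1) := by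
    refine Integrable.mono' hsum.integrableOn (by fun_prop) ?_
    filter_upwards [ae_restrict_mem measurableSet_Ioi] with z hz
    have hz1 : (1:ℝ) < z := hz
    have hz0 : (0:ℝ) < z := by linarith
    have hs := s_pos z
    rw [Real.norm_of_nonneg (by positivity)]
    simp only [Pi.add_apply, neg_sq]
    rw [← add_mul]
    have hA : ‖C‖ * (2 * k * (z * (1 + z^2) ^ (p-1))) ≤ ‖w z‖ + ‖w (-z)‖ := by
      have h1 := (hlow z hz0.le).trans (Complex.re_le_norm _)
      rw [norm_div, le_div_iff₀ hCn] at h1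
      calc _ = _ := mul_comm _ _
        _ ≤ _ := h1.trans (norm_sub_le _ _)
    have hx : 0 < ((1 + z^2) ^ (p-1) : ℝ) := Real.rpow_pos_of_pos hs _
    have hB : 2 * (‖C‖ * (k * (z * (1 + z^2) ^ (p-1))))^2 ≤ ‖w z‖^2 + ‖w (-z)‖^2 := by
      have h0 : 0 ≤ ‖C‖ * (2 * k * (z * (1 + z^2) ^ (p-1))) := by positivity
      have := pow_le_pow_left₀ h0 hA 2
      nlinarith [sq_nonneg (‖w z‖ - ‖w (-z)‖)]
    have hy : 0 < ((1 + z^2) ^ (-p) : ℝ) := Real.rpow_pos_of_pos hs _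
    refine le_trans ?_ (mul_le_mul_of_nonneg_right hB hy.le)
    have hC1 : ((1 + z^2) ^ (p-1) : ℝ)^2 * (1 + z^2) ^ (-p) = (1 + z^2) ^ (p - 2) := by
      rw [← Real.rpow_natCast ((1 + z^2) ^ (p-1)), ← Real.rpow_mul hs.le, ← Real.rpow_add hs]
      congr 1
      push_cast
      ring
    have hD : ((1 + z^2) ^ (-(3/2) : ℝ) : ℝ) ≤ (1 + z^2) ^ (p - 2) :=
      Real.rpow_le_rpow_of_exponent_le (by nlinarith) (by linarith)
    have hE : (4 * z^2) ^ (-(3/2) : ℝ) ≤ ((1 + z^2) ^ (-(3/2) : ℝ) : ℝ) :=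
      Real.rpow_le_rpow_of_nonpos hs (by nlinarith) (by norm_num)
    have hF : (4 * z^2) ^ (-(3/2) : ℝ) = 1 / (8 * z^3) := by
      rw [show 4 * z^2 = (2*z)^(2:ℝ) by norm_cast; ring, ← Real.rpow_mul (by positivity),
        show (2:ℝ) * -(3/2) = -((3:ℕ):ℝ) by norm_num, Real.rpow_neg (by positivity),
        Real.rpow_natCast]
      field_simp
      norm_num
    have hG : 1 / (8 * z^3) ≤ (1 + z^2) ^ (p - 2) := by linarith
    have hH : ‖C‖^2 * k^2 / 4 * z⁻¹ = 2 * ‖C‖^2 * k^2 * z^2 * (1 / (8 * z^3)) := by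
      field_simp
      norm_num
    have hI : 2 * (‖C‖ * (k * (z * (1 + z^2) ^ (p-1))))^2 * (1 + z^2) ^ (-p)
        = 2 * ‖C‖^2 * k^2 * z^2 * (1 + z^2) ^ (p - 2) := by
      rw [← hC1]; ring
    rw [hH, hI]
    exact mul_le_mul_of_nonneg_left hG (by positivity)
  have hc : ‖C‖^2 * k^2 / 4 ≠ 0 := by positivity
  have := hbig.const_mul (‖C‖^2 * k^2 / 4)⁻¹
  refine not_integrableOn_Ioi_inv (a := 1) ?_
  refine Integrable.congr this (Filter.Eventually.of_forall fun z => ?_)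
  simp only
  rw [← mul_assoc, inv_mul_cancel₀ hc, one_mul]

lemma part3 (a : ℝ) (ha : a < 1) (v : ℝ → ℂ) (hv : ContDiff ℝ 2 v)
    (ho : ∀ z : ℝ,
        ((1 + z^2 : ℝ) : ℂ) * deriv (deriv v) z
          - (((a - 4) * z : ℝ) : ℂ) * deriv v z
          - ((a - 2 : ℝ) : ℂ) * v z = 0)
    (hi : Integrable (fun z : ℝ => ‖v z‖^2 * ((1 + z^2) ^ ((2-a)/2) : ℝ))) :
    ∃ c : ℂ, ∀ z : ℝ, v z = c * (((1 + z^2) ^ ((a-2)/2) : ℝ) : ℂ) := by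
  have hv1 : ∀ z, HasDerivAt v (deriv v z) z := fun z =>
    (hv.differentiable (by norm_num) z).hasDerivAt
  have hv' : ContDiff ℝ 1 (deriv v) := by
    have : ContDiff ℝ (1 + 1) v := by simpa [one_add_one_eq_two] using hv
    exact (contDiff_succ_iff_deriv.mp this).2.2
  have hv2 : ∀ z, HasDerivAt (deriv v) (deriv (deriv v) z) z := fun z =>
    (hv'.differentiable (by norm_num) z).hasDerivAt
  let f : ℝ → ℂ := fun z => ((1 + z^2 : ℝ) : ℂ) * deriv v z + (((2 - a) * z : ℝ) : ℂ) * v z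
  have hf : ∀ z, HasDerivAt f 0 z := by
    intro z
    have h1 : HasDerivAt (fun z : ℝ => 1 + z^2) (2 * z) z := by
      simpa using (hasDerivAt_pow 2 z).const_add 1
    have h2 : HasDerivAt (fun z : ℝ => (2 - a) * z) (2 - a) z := by
      simpa using (hasDerivAt_id z).const_mul (2 - a)
    have h3 := (h1.ofReal_comp.mul (hv2 z)).add (h2.ofReal_comp.mul (hv1 z))
    refine h3.congr_deriv ?_
    rw [← ho z]
    push_cast
    ring
  have hfc : ∀ z, f z = f 0 := fun z =>
    is_const_of_deriv_eq_zero (fun z => (hf z).differentiableAt) (fun z => (hf z).deriv) z 0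
  set p := (2 - a)/2 with hp
  let w : ℝ → ℂ := fun z => (((1 + z^2) ^ p : ℝ) : ℂ) * v z
  have hw : ∀ z, HasDerivAt w (f 0 * (((1 + z^2) ^ (p-1) : ℝ) : ℂ)) z := by
    intro z
    refine ((hd_s p z).ofReal_comp.mul (hv1 z)).congr_deriv ?_
    rw [← hfc z, ← rp_sub p z, hp]
    simp only [f]
    push_cast
    ring
  have hwi : Integrable (fun z : ℝ => ‖w z‖^2 * ((1 + z^2) ^ (-p) : ℝ)) := by
    refine hi.congr (Filter.Eventually.of_forall fun z => ?_)
    have hs := s_pos z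
    have hx : 0 < ((1 + z^2) ^ p : ℝ) := Real.rpow_pos_of_pos hs _
    simp only [w, norm_mul, Complex.norm_real, Real.norm_eq_abs, abs_of_pos hx]
    rw [Real.rpow_neg hs.le]
    field_simp
  have hC := key p (by rw [hp]; linarith) w (f 0) hw hwi
  have hwc : ∀ z, w z = w 0 := fun z =>
    is_const_of_deriv_eq_zero (fun z => (hw z).differentiableAt)
      (fun z => by rw [(hw z).deriv, hC, zero_mul]) z 0
  refine ⟨w 0, fun z => ?_⟩
  rw [← hwc z]
  have hs := s_pos z
  have : ((1 + z^2) ^ p : ℝ) * (1 + z^2) ^ ((a-2)/2) = 1 := by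
    rw [← Real.rpow_add hs, show p + (a-2)/2 = 0 by rw [hp]; ring, Real.rpow_zero]
  have h2 : (((1 + z^2) ^ p : ℝ) : ℂ) * (((1 + z^2) ^ ((a-2)/2) : ℝ) : ℂ) = 1 := by
    exact_mod_cast this
  simp only [w]
  linear_combination (-v z) * h2

/-- for a < 1, the function v₀(z) = (1+z²)^{(a-2)/2} solves
(1+z²)v'' - (a-4)z v' - (a-2)v = 0 on ℝ and satisfies ∫ |v₀|²(1+z²)^{(2-a)/2} < ∞;
moreover every C² solution of the ODE with this integrability property is a scalar
multiple of v₀. -/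
theorem stmt15 (a : ℝ) (ha : a < 1) :
    (∀ z : ℝ,
      ((1 + z^2 : ℝ) : ℂ) *
          deriv (deriv (fun z : ℝ => (((1 + z^2) ^ ((a-2)/2) : ℝ) : ℂ))) z
        - (((a - 4) * z : ℝ) : ℂ) *
            deriv (fun z : ℝ => (((1 + z^2) ^ ((a-2)/2) : ℝ) : ℂ)) z
        - ((a - 2 : ℝ) : ℂ) * (((1 + z^2) ^ ((a-2)/2) : ℝ) : ℂ) = 0) ∧
    Integrable (fun z : ℝ =>
      ‖(((1 + z^2) ^ ((a-2)/2) : ℝ) : ℂ)‖^2 * ((1 + z^2) ^ ((2-a)/2) : ℝ)) ∧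
    (∀ v : ℝ → ℂ, ContDiff ℝ 2 v →
      (∀ z : ℝ,
        ((1 + z^2 : ℝ) : ℂ) * deriv (deriv v) z
          - (((a - 4) * z : ℝ) : ℂ) * deriv v z
          - ((a - 2 : ℝ) : ℂ) * v z = 0) →
      Integrable (fun z : ℝ => ‖v z‖^2 * ((1 + z^2) ^ ((2-a)/2) : ℝ)) →
      ∃ c : ℂ, ∀ z : ℝ, v z = c * (((1 + z^2) ^ ((a-2)/2) : ℝ) : ℂ)) := by
  exact ⟨part1 a, part2 a ha, part3 a ha⟩

end
end

section
/- Let n ≥ 2 and 0 ≤ p ≤ n/2 be integers and let 2 − n + 2p < a < 1. Then every twice continuously differentiable function v : ℝ → ℂ satisfying (1 + z²) v''(z) − (a − 4) z v'(z) − (n − 2p + a − 2) v(z) = 0 for all z ∈ ℝ together with ∫_ℝ |v(z)|² (1 + z²)^{(2−a)/2} dz < ∞ is identically zero. -/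
open MeasureTheory

noncomputable section

lemma aux_const (S : Set ℝ) (hS : MeasurableSet S) (hvol : volume S = ⊤) (F : ℝ → ℝ)
    (hF : Integrable F) (e : ℝ) (he : 0 < e) (h : ∀ z ∈ S, e ≤ F z) : False := by
  have h1 : IntegrableOn (fun _ : ℝ => e) S := by
    refine Integrable.mono' hF.integrableOn aestronglyMeasurable_const ?_
    refine (ae_restrict_iff' hS).2 (Filter.Eventually.of_forall fun z hz => ?_)
    rw [Real.norm_of_nonneg he.le]
    exact h z hz
  rw [integrableOn_const_iff] at h1
  rcases h1 with h1 | h1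
  · simp only [enorm_eq_zero] at h1; exact he.ne' h1
  · rw [hvol] at h1; exact lt_irrefl _ h1

/-- for integers n ≥ 2, 0 ≤ p ≤ n/2 and 2-n+2p < a < 1, every C² solution
v of (1+z²)v'' - (a-4)z v' - (n-2p+a-2)v = 0 on ℝ with ∫|v|²(1+z²)^{(2-a)/2} < ∞ is
identically zero. -/
theorem stmt16 (n p : ℕ) (hn : 2 ≤ n) (hp : 2*p ≤ n)
    (a : ℝ) (ha1 : 2 - (n:ℝ) + 2*p < a) (ha2 : a < 1)
    (v : ℝ → ℂ) (hv : ContDiff ℝ 2 v)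
    (hode : ∀ z : ℝ,
      ((1 + z^2 : ℝ) : ℂ) * deriv (deriv v) z
        - (((a - 4) * z : ℝ) : ℂ) * deriv v z
        - ((((n:ℝ) - 2*p + a - 2) : ℝ) : ℂ) * v z = 0)
    (hint : Integrable (fun z : ℝ => ‖v z‖^2 * ((1 + z^2) ^ ((2-a)/2) : ℝ))) :
    ∀ z : ℝ, v z = 0 := by
  obtain ⟨c, hc⟩ : ∃ c : ℝ, c = (n:ℝ) - 2*p + a - 2 := ⟨_, rfl⟩
  have hc0 : 0 < c := by rw [hc]; linarith
  rw [← hc] at hode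
  have hd : ∀ z, HasDerivAt v (deriv v z) z := fun z =>
    (hv.differentiable (by norm_num) z).hasDerivAt
  have hv1 : ContDiff ℝ 1 (deriv v) := by
    have : ContDiff ℝ (1+1) v := by norm_num; exact hv
    exact (contDiff_succ_iff_deriv.1 this).2.2
  have hd2 : ∀ z, HasDerivAt (deriv v) (deriv (deriv v) z) z := fun z =>
    (hv1.differentiable (by norm_num) z).hasDerivAt
  have hN : ∀ z, HasDerivAt (fun z => ‖v z‖^2) (2 * inner ℝ (v z) (deriv v z)) z := fun z =>
    (hd z).norm_sq
  have hpos : ∀ z : ℝ, 0 < 1 + z^2 := fun z => by positivity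
  have hw : ∀ z : ℝ, HasDerivAt (fun z : ℝ => (1+z^2 : ℝ)^((4-a)/2))
      ((4-a) * z * (1+z^2 : ℝ)^((4-a)/2-1)) z := by
    intro z
    have h1 : HasDerivAt (fun z : ℝ => 1+z^2) (2*z) z := by
      simpa using (hasDerivAt_pow 2 z).const_add 1
    convert h1.rpow_const (p := (4-a)/2) (Or.inl (hpos z).ne') using 1
    ring
  have hI : ∀ z, HasDerivAt (fun z => (inner ℝ (v z) (deriv v z) : ℝ))
      (inner ℝ (v z) (deriv (deriv v) z) + inner ℝ (deriv v z) (deriv v z)) z := fun z =>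
    (hd z).inner ℝ (hd2 z)
  have hM := fun z => (hw z).mul (hI z)
  have hmono : Monotone (fun z : ℝ => (1+z^2 : ℝ)^((4-a)/2) * inner ℝ (v z) (deriv v z)) := by
    refine monotone_of_hasDerivAt_nonneg (fun z => hM z) ?_
    intro z
    have e1 : (1+z^2 : ℝ)^((4-a)/2) = (1+z^2 : ℝ)^((4-a)/2-1) * (1+z^2) := by
      rw [Real.rpow_sub_one (hpos z).ne']; field_simp [(hpos z).ne']
    have e2 : (1+z^2) * (inner ℝ (v z) (deriv (deriv v) z) : ℝ)
        - (a-4) * z * inner ℝ (v z) (deriv v z) - c * ‖v z‖^2 = 0 := by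
      have := congrArg (fun x => (inner ℝ (v z) x : ℝ)) (hode z)
      simp only [inner_sub_right, ← Complex.real_smul, real_inner_smul_right,
        real_inner_self_eq_norm_sq, inner_zero_right] at this
      exact this
    have h3 : 0 ≤ (1+z^2 : ℝ)^((4-a)/2-1) * ((1+z^2) * ‖deriv v z‖^2 + c * ‖v z‖^2) := by
      have := hpos z
      positivity
    simp only [Pi.zero_apply, e1, real_inner_self_eq_norm_sq]
    refine h3.trans_eq ?_
    linear_combination (-(1+z^2 : ℝ)^((4-a)/2-1)) * e2
  have hwpos : ∀ z : ℝ, 0 < (1+z^2 : ℝ)^((4-a)/2) := fun z => Real.rpow_pos_of_pos (hpos z) _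
  have hge : ∀ z, ‖v z‖^2 ≤ ‖v z‖^2 * ((1 + z^2) ^ ((2-a)/2) : ℝ) := by
    intro z
    refine le_mul_of_one_le_right (by positivity) (Real.one_le_rpow ?_ ?_)
    · nlinarith [sq_nonneg z]
    · linarith
  have hcont : Continuous (fun z => ‖v z‖^2) := by
    have := hv.continuous
    fun_prop
  have hzero : ∀ z, (inner ℝ (v z) (deriv v z) : ℝ) = 0 := by
    intro z0
    rcases lt_trichotomy (inner ℝ (v z0) (deriv v z0) : ℝ) 0 with h | h | h
    · exfalso
      have hneg : ∀ z ≤ z0, (inner ℝ (v z) (deriv v z) : ℝ) < 0 := by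
        intro z hz
        have h1 := hmono hz
        have h2 := mul_neg_of_pos_of_neg (hwpos z0) h
        exact (pos_iff_neg_of_mul_neg (lt_of_le_of_lt h1 h2)).1 (hwpos z)
      have hanti : StrictAntiOn (fun z => ‖v z‖^2) (Set.Iic z0) := by
        refine strictAntiOn_of_deriv_neg (convex_Iic z0) hcont.continuousOn ?_
        intro z hz
        rw [interior_Iic] at hz
        rw [(hN z).deriv]
        linarith [hneg z (le_of_lt hz)]
      have h1 := hanti (a := z0 - 1) (b := z0) (by simp) (by simp) (by linarith)
      refine aux_const (Set.Iic (z0-1)) measurableSet_Iic Real.volume_Iic _ hint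
        (‖v (z0-1)‖^2) (lt_of_le_of_lt (by positivity) h1) ?_
      intro z hz
      have hz' : z ≤ z0 - 1 := hz
      refine le_trans ?_ (hge z)
      exact hanti.antitoneOn (by simp; linarith) (by simp) hz'
    · exact h
    · exfalso
      have hneg : ∀ z ≥ z0, 0 < (inner ℝ (v z) (deriv v z) : ℝ) := by
        intro z hz
        have h1 := hmono hz
        have h2 := mul_pos (hwpos z0) h
        exact (pos_iff_pos_of_mul_pos (lt_of_lt_of_le h2 h1)).1 (hwpos z)
      have hanti : StrictMonoOn (fun z => ‖v z‖^2) (Set.Ici z0) := by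
        refine strictMonoOn_of_deriv_pos (convex_Ici z0) hcont.continuousOn ?_
        intro z hz
        rw [interior_Ici] at hz
        rw [(hN z).deriv]
        linarith [hneg z (le_of_lt hz)]
      have h1 := hanti (a := z0) (b := z0 + 1) (by simp) (by simp) (by linarith)
      refine aux_const (Set.Ici (z0+1)) measurableSet_Ici Real.volume_Ici _ hint
        (‖v (z0+1)‖^2) (lt_of_le_of_lt (by positivity) h1) ?_
      intro z hz
      have hz' : z0 + 1 ≤ z := hz
      refine le_trans ?_ (hge z)
      exact hanti.monotoneOn (by simp) (by simp; linarith) hz'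
  have hconst : ∀ x y, ‖v x‖^2 = ‖v y‖^2 := by
    refine is_const_of_deriv_eq_zero (f := fun z => ‖v z‖^2)
      (fun z => (hN z).differentiableAt) ?_
    intro z
    rw [(hN z).deriv, hzero z, mul_zero]
  intro z
  by_contra hz
  have : 0 < ‖v z‖^2 := by positivity
  refine aux_const Set.univ MeasurableSet.univ Real.volume_univ _ hint _ this ?_
  intro y _
  rw [hconst z y]
  exact hge y

end
end

section
/- Let n ≥ 2 and 0 ≤ p ≤ n/2 be integers and let 2 − n + 2p < a < 1. Consider the coupled system of ODEs on ℝ: (1 + z²) v''(z) − (a − 4) z v'(z) − (a − 2) v(z) + 2 w'(z) = 0 and (1 + z²) w''(z) − (a − 4) z w'(z) − (n − 2p + a − 2) w(z) − 2 v'(z) = 0. Then the pair v_0(z) = [(n − 2p + a − 2) z² + (n − 2p − a + 2)] (1 + z²)^{(a−4)/2}, w_0(z) = 2(2 − a) z (1 + z²)^{(a−4)/2} is a solution satisfying ∫_ℝ (|v_0|² + |w_0|²)(1 + z²)^{(2−a)/2} dz < ∞, and every twice continuously differentiable solution pair (v, w) on ℝ with ∫_ℝ |v(z)|² (1 + z²)^{(2−a)/2}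 dz < ∞ and ∫_ℝ |w(z)|² (1 + z²)^{(2−a)/2} dz < ∞ is a scalar multiple of (v_0, w_0). -/
open MeasureTheory

noncomputable section

/-- the solution pair (v₀, w₀) of the coupled system -/
def v0 (n p : ℕ) (a : ℝ) : ℝ → ℂ := fun z =>
  (((((n:ℝ) - 2*p + a - 2) * z^2 + ((n:ℝ) - 2*p - a + 2)) * (1 + z^2) ^ ((a-4)/2) : ℝ) : ℂ)

def w0 (a : ℝ) : ℝ → ℂ := fun z =>
  ((2 * (2 - a) * z * (1 + z^2) ^ ((a-4)/2) : ℝ) : ℂ)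


lemma growth (K F F' : ℝ → ℝ) (hK : Continuous K) (hKi : Integrable K) (hK0 : ∀ z, 0 ≤ K z)
    (z0 c M : ℝ) (hz0 : 1 ≤ z0) (hc : 0 < c) (hM : 0 ≤ M)
    (hF : ∀ z, z0 ≤ z → HasDerivAt F (F' z) z)
    (hF' : ∀ z, z0 ≤ z → c / z - M * K z ≤ F' z) (B : ℝ) :
    ∃ z1, z0 ≤ z1 ∧ ∀ z, z1 ≤ z → B ≤ F z := by
  have hJ : ∀ z, HasDerivAt (fun z => ∫ t in z0..z, K t) (K z) z := fun z =>
    intervalIntegral.integral_hasDerivAt_right (hK.intervalIntegrable _ _)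
      hK.stronglyMeasurable.stronglyMeasurableAtFilter hK.continuousAt
  have hH : ∀ z, z0 ≤ z → HasDerivAt (fun z => F z + M * (∫ t in z0..z, K t) - c * Real.log z)
      (F' z + M * K z - c * z⁻¹) z := fun z hz =>
    ((hF z hz).add ((hJ z).const_mul M)).sub ((Real.hasDerivAt_log (by linarith)).const_mul c)
  have hmono : MonotoneOn (fun z => F z + M * (∫ t in z0..z, K t) - c * Real.log z) (Set.Ici z0) := by
    apply monotoneOn_of_deriv_nonneg (convex_Ici z0)
    · intro z hz
      exact (hH z hz).continuousAt.continuousWithinAt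
    · intro z hz
      rw [interior_Ici] at hz
      exact (hH z (le_of_lt hz)).differentiableAt.differentiableWithinAt
    · intro z hz
      rw [interior_Ici] at hz
      rw [(hH z (le_of_lt hz)).deriv]
      have := hF' z (le_of_lt hz)
      rw [div_eq_mul_inv] at this
      linarith
  have hI : ∀ z, z0 ≤ z → (∫ t in z0..z, K t) ≤ ∫ t, K t := by
    intro z hz
    rw [intervalIntegral.integral_of_le hz]
    exact setIntegral_le_integral hKi (Filter.Eventually.of_forall hK0)
  have ht : Filter.Tendsto (fun z => c * Real.log z) Filter.atTop Filter.atTop :=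
    Real.tendsto_log_atTop.const_mul_atTop hc
  obtain ⟨z1, h1⟩ := Filter.eventually_atTop.1 (ht.eventually_ge_atTop
    (B - F z0 + c * Real.log z0 + M * ∫ t, K t))
  refine ⟨max z0 z1, le_max_left _ _, fun z hz => ?_⟩
  have hz' := (le_max_left z0 z1).trans hz
  have h2 := h1 z ((le_max_right _ _).trans hz)
  have h3 := hmono (Set.mem_Ici.2 le_rfl) (Set.mem_Ici.2 hz') hz'
  simp only [intervalIntegral.integral_same, mul_zero] at h3
  have h4 := mul_le_mul_of_nonneg_left (hI z hz') hM
  linarith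

/-- One-sided Liouville lemma. -/
lemma liou_half (K A Y α γ : ℝ → ℝ) (hK : Continuous K) (hKi : Integrable K) (hK0 : ∀ z, 0 ≤ K z)
    (M : ℝ) (hM : 0 < M)
    (hA : ∀ z, HasDerivAt A (α z * Y z) z) (hY : ∀ z, HasDerivAt Y (γ z * A z) z)
    (hα : ∀ z, 0 ≤ α z) (hγ : ∀ z, 0 < γ z)
    (hb : ∀ z, Y z ^ 2 ≤ γ z * ((1 + z^2) * (M * K z))) (z0 : ℝ) : A z0 * Y z0 ≤ 0 := by
  by_contra! hpos
  have hE : ∀ z, HasDerivAt (fun z => A z * Y z) (α z * Y z * Y z + A z * (γ z * A z)) z :=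
    fun z => (hA z).mul (hY z)
  have hmono : Monotone (fun z => A z * Y z) := by
    apply monotone_of_deriv_nonneg (fun z => (hE z).differentiableAt)
    intro z
    rw [(hE z).deriv]
    have := mul_nonneg (hα z) (mul_self_nonneg (Y z))
    have := mul_nonneg (hγ z).le (mul_self_nonneg (A z))
    nlinarith
  have hp : ∀ z, max 1 z0 ≤ z → 0 < A z * Y z := fun z hz =>
    hpos.trans_le (hmono ((le_max_right _ _).trans hz))
  obtain ⟨z1, h1, h2⟩ := growth K (fun z => -(A z * Y z)⁻¹)
    (fun z => -(-(α z * Y z * Y z + A z * (γ z * A z)) / (A z * Y z)^2)) hK hKi hK0 (max 1 z0)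
    1 M (le_max_left _ _) one_pos hM.le
    (fun z hz => ((hE z).inv (hp z hz).ne').neg) (by
      intro z hz
      have hz1 : 1 ≤ z := (le_max_left _ _).trans hz
      have hE0 := hp z hz
      have hA0 : A z ≠ 0 := by rintro h; simp [h] at hE0
      have hY0 : Y z ≠ 0 := by rintro h; simp [h] at hE0
      have hY2 : 0 < Y z ^ 2 := by positivity
      have hA2 : 0 < A z ^ 2 := by positivity
      have hg := hγ z
      have hL0 : 0 < M * K z := by
        have h5 := hY2.trans_le (hb z)
        have h6 : 0 < (1 + z^2) * (M * K z) := by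
          by_contra! h; nlinarith
        by_contra! h
        nlinarith [sq_nonneg z]
      have e1 : γ z / Y z ^ 2 ≤ -(-(α z * Y z * Y z + A z * (γ z * A z)) / (A z * Y z)^2) := by
        rw [neg_div, neg_neg, div_le_div_iff₀ (by positivity) (by positivity)]
        have := mul_nonneg (mul_nonneg (hα z) hY2.le) hY2.le
        nlinarith
      have e2 : 1 / ((1 + z^2) * (M * K z)) ≤ γ z / Y z ^ 2 := by
        rw [div_le_div_iff₀ (by positivity) hY2]
        linarith [hb z]
      refine le_trans ?_ (e2.trans e1)
      generalize M * K z = L at *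
      have hz0 : 0 < z := by linarith
      rw [sub_le_iff_le_add, div_le_iff₀ hz0]
      have : 1 / ((1 + z^2) * L) + L = (1 + (1+z^2) * L^2) / ((1 + z^2) * L) := by
        field_simp
      rw [this, div_mul_eq_mul_div, le_div_iff₀ (by positivity)]
      -- (1+z²)L ≤ z(1+(1+z²)L²)
      by_cases h : L * z ≤ 1
      · by_cases h' : z * L * z ≤ z - L
        · nlinarith [mul_pos hz0 (pow_pos hL0 2)]
        · nlinarith [sq_nonneg (z * L - 1), sq_nonneg (z*L), sq_nonneg (2*z*L-1), sq_nonneg (z-1), mul_pos hz0 hL0]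
      · nlinarith [mul_pos hL0 (by positivity : (0:ℝ) < 1 + z^2), mul_pos hz0 hL0]) 0
  have h3 := h2 z1 le_rfl
  have h4 := inv_pos.2 (hp z1 h1)
  linarith

lemma liou (K A Y α γ : ℝ → ℝ) (hK : Continuous K) (hKi : Integrable K) (hK0 : ∀ z, 0 ≤ K z)
    (M : ℝ) (hM : 0 < M)
    (hA : ∀ z, HasDerivAt A (α z * Y z) z) (hY : ∀ z, HasDerivAt Y (γ z * A z) z)
    (hα : ∀ z, 0 ≤ α z) (hα1 : 0 < α 1) (hγ : ∀ z, 0 < γ z)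
    (hb : ∀ z, Y z ^ 2 ≤ γ z * ((1 + z^2) * (M * K z))) (z : ℝ) : Y z = 0 := by
  have h1 := liou_half K A Y α γ hK hKi hK0 M hM hA hY hα hγ hb
  have h2 := liou_half (fun z => K (-z)) (fun z => - A (-z)) (fun z => Y (-z)) (fun z => α (-z))
    (fun z => γ (-z)) (by fun_prop) hKi.comp_neg (fun z => hK0 _) M hM
    (fun z => by
      have := ((hA (-z)).comp z (hasDerivAt_neg z)).neg
      exact this.congr_deriv (by simp))
    (fun z => by
      have := ((hY (-z)).comp z (hasDerivAt_neg z))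
      simpa [Function.comp_def] using this)
    (fun z => hα _) (fun z => hγ _) (fun z => by simpa using hb (-z))
  have hE0 : (fun z => A z * Y z) = fun _ => 0 := by
    funext z
    have := h2 (-z)
    simp only [neg_neg] at this
    linarith [h1 z]
  have hE : ∀ z, α z * Y z * Y z + A z * (γ z * A z) = 0 := fun z => by
    have := (hA z).mul (hY z)
    have h3 : A * Y = fun _ => 0 := hE0
    rw [h3] at this
    exact this.unique (hasDerivAt_const z 0)
  have hA0 : ∀ z, A z = 0 := fun z => by
    have := hE z
    have h3 := mul_nonneg (hα z) (mul_self_nonneg (Y z))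
    have h4 : γ z * (A z)^2 = 0 := le_antisymm (by nlinarith) (mul_nonneg (hγ z).le (sq_nonneg _))
    simpa [(hγ z).ne'] using h4
  have hc : Y z = Y 1 := is_const_of_deriv_eq_zero (fun z => (hY z).differentiableAt)
    (fun z => by rw [(hY z).deriv, hA0, mul_zero]) _ _
  rw [hc]
  have := hE 1
  rw [hA0] at this
  simpa [hα1.ne'] using this

lemma C_le (K v v1 w : ℝ → ℝ) (hK : Continuous K) (hKi : Integrable K) (hK0 : ∀ z, 0 ≤ K z)
    (β C : ℝ) (hβ : 1 < β) (hv : ∀ z, HasDerivAt v (v1 z) z)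
    (hb : ∀ z, 1 ≤ z → z * (v z ^ 2 + w z ^2) ≤ K z)
    (heq : ∀ z, (1 + z^2) * v1 z + β * z * v z + 2 * w z = C) : C ≤ 0 := by
  by_contra! hC
  obtain ⟨z1, h1, h2⟩ := growth K (fun z => z * v z) (fun z => 1 * v z + z * v1 z) hK hKi hK0 1
    (C/4) (2 * (1+β)^2 / C + 8 / C) le_rfl (by positivity) (by positivity)
    (fun z _ => (hasDerivAt_id' z).mul (hv z)) (by
      intro z hz
      have hz0 : 0 < z := by linarith
      have hT : 0 < 1 + z^2 := by positivity
      have e : 1 * v z + z * v1 z = C * (z / (1+z^2)) + v z * (1 - β * (z^2/(1+z^2)))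
          - 2 * w z * (z/(1+z^2)) := by
        have : v1 z = (C - β * z * v z - 2 * w z) / (1+z^2) := by
          rw [eq_div_iff hT.ne']; linarith [heq z]
        rw [this]; field_simp; ring
      have r1 : 1/(2*z) ≤ z/(1+z^2) := by
        rw [div_le_div_iff₀ (by positivity) hT]; nlinarith
      have r2 : z/(1+z^2) ≤ 1/z := by
        rw [div_le_div_iff₀ hT hz0]; nlinarith
      have r3 : 0 ≤ z^2/(1+z^2) := by positivity
      have r4 : z^2/(1+z^2) ≤ 1 := by
        rw [div_le_one hT]; linarith
      have b1 : -((1+β) * |v z|) ≤ v z * (1 - β * (z^2/(1+z^2))) := by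
        have : |1 - β * (z^2/(1+z^2))| ≤ 1 + β := by
          rw [abs_le]; constructor <;> nlinarith
        have h3 := neg_abs_le (v z * (1 - β * (z^2/(1+z^2))))
        rw [abs_mul] at h3
        nlinarith [mul_le_mul_of_nonneg_left this (abs_nonneg (v z))]
      have b2 : 2 * w z * (z/(1+z^2)) ≤ 2 * |w z| * (1 / z) := by
        have := le_abs_self (w z)
        have r5 : 0 ≤ z/(1+z^2) := by positivity
        nlinarith [mul_le_mul_of_nonneg_right this r5, mul_le_mul_of_nonneg_left r2 (abs_nonneg (w z))]
      have b3 : (1+β) * |v z| ≤ C / 8 / z + 2 * (1+β)^2 / C * (z * v z ^2) := by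
        rw [← sq_abs (v z)]
        have : C / 8 / z + 2 * (1+β)^2 / C * (z * |v z| ^2) - (1+β) * |v z| =
          2 / (C * z) * ((1+β) * z * |v z| - C / 4)^2 := by field_simp; ring
        have h0 : 0 ≤ 2 / (C * z) * ((1+β) * z * |v z| - C / 4)^2 := by positivity
        linarith
      have b4 : 2 * |w z| * (1/z) ≤ C / 8 / z + 8 / C * (z * w z ^2) := by
        rw [← sq_abs (w z)]
        have h7 : C / 8 / z + 8 / C * (1 / z * |w z| ^2) - 2 * |w z| * (1/z) =
          8 / (C * z) * (|w z| - C / 8)^2 := by field_simp; ring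
        have h0 : 0 ≤ 8 / (C * z) * (|w z| - C / 8)^2 := by positivity
        have h8 : 1/z * |w z|^2 ≤ z * |w z|^2 := by
          apply mul_le_mul_of_nonneg_right _ (sq_nonneg _)
          rw [div_le_iff₀ hz0]; nlinarith
        have := mul_le_mul_of_nonneg_left h8 (by positivity : 0 ≤ 8 / C)
        linarith
      have b5 : 2 * (1+β)^2 / C * (z * v z ^2) ≤ 2 * (1+β)^2 / C * K z := by
        apply mul_le_mul_of_nonneg_left _ (by positivity)
        have := hb z hz; nlinarith [mul_nonneg hz0.le (sq_nonneg (w z))]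
      have b6 : 8 / C * (z * w z ^2) ≤ 8 / C * K z := by
        apply mul_le_mul_of_nonneg_left _ (by positivity)
        have := hb z hz; nlinarith [mul_nonneg hz0.le (sq_nonneg (v z))]
      have b7 := mul_le_mul_of_nonneg_left r1 hC.le
      have b8 : C * (1/(2*z)) = C/8/z + C/8/z + C/4/z := by field_simp; ring
      rw [e]
      linarith) 1
  obtain ⟨z2, h3, h4⟩ := growth K (fun z => 0) (fun z => 0) hK hKi hK0 z1 1 1 h1 one_pos zero_le_one
    (fun z _ => hasDerivAt_const z 0) (by
      intro z hz
      have hz1 := h1.trans hz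
      have hz0 : 0 < z := by linarith
      have h5 := h2 z hz
      have h6 := hb z hz1
      have : 1 / z ≤ z * v z ^2 := by
        rw [div_le_iff₀ hz0]; nlinarith
      nlinarith [mul_nonneg hz0.le (sq_nonneg (w z))]) 1
  have := h4 z2 le_rfl
  linarith

lemma hd_rpow (e z : ℝ) : HasDerivAt (fun z : ℝ => (1 + z^2) ^ e)
    (2 * e * z / (1+z^2) * (1+z^2)^e) z := by
  have hT : 0 < 1 + z^2 := by positivity
  have h := ((hasDerivAt_pow 2 z).const_add 1).rpow_const (p := e) (Or.inl hT.ne')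
  have h2 : (1+z^2)^(e-1) = (1+z^2)^e / (1+z^2) := by rw [Real.rpow_sub hT, Real.rpow_one]
  refine h.congr_deriv ?_
  rw [h2]; simp; ring

/-- The algebraic identity behind the reduced Sturm-type system. -/
lemma alg_id (m β z θ v w w1 v1 w2 T N G G1 G2 X X1 X1d S Sd : ℝ)
    (hT : T = 1 + z^2) (hT0 : T ≠ 0)
    (hN : N = (m-β)*z^2 + (m+β))
    (hG : G = ((m-2)*z^2+m+2)*N + 8*β*z^2 + 4*β*m*(z+z^3)*θ)
    (hG1 : G1 = 2*(m-2)*z*N + ((m-2)*z^2+m+2)*(2*(m-β)*z) + 16*β*z + 4*β*m*((1+3*z^2)*θ + z))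
    (hG2 : G2 = 2*(m-2)*N + 2*(m-2)*z*(2*(m-β)*z) + 2*(m-2)*z*(2*(m-β)*z)
      + ((m-2)*z^2+m+2)*(2*(m-β)) + 16*β + 4*β*m*(6*z*θ + (1+3*z^2)/T + 1))
    (hX : X = w * N - 2*β*z*v)
    (hX1 : X1 = T*N*w1 + 2*(m-β)*z*T*w - 2*β*T*v + 2*β*z*(β*z*v+2*w))
    (hX1d : X1d = 2*z*N*w1 + T*(2*(m-β)*z)*w1 + T*N*w2 + 2*(m-β)*(1+3*z^2)*w
      + 2*(m-β)*z*T*w1 - 4*β*z*v - 2*β*T*v1 + 2*β*(2*β*z*v + β*z^2*v1 + 2*w + 2*z*w1))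
    (hS : S = G*(X1+(β+2)*z*X) - T*X*G1)
    (hSd : Sd = G1*(X1+(β+2)*z*X) + G*(X1d+(β+2)*X+(β+2)*z*(X1/T)) - 2*z*X*G1 - X1*G1 - T*X*G2)
    (hv1 : v1 = (-β*z*v - 2*w)/T)
    (hw2 : w2 = (-(β+2)*z*w1 + (m-β)*w + 2*v1)/T) :
    Sd*T*N - S*(4*z*N + 2*(m-β)*z*T) = T*N^2*(m*(m-2)*T + 4*m*β*z*θ)*X := by
  have h1 : T * v1 = -β*z*v - 2*w := by rw [hv1]; field_simp
  have h2 : T * w2 = -(β+2)*z*w1 + (m-β)*w + 2*v1 := by rw [hw2]; field_simp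
  subst hSd hS hX1d hG2
  clear hv1 hw2
  have e1 : T * (T * w2) = T*(-(β+2)*z*w1 + (m-β)*w) + 2*(-β*z*v - 2*w) := by
    rw [h2]; linear_combination 2 * h1
  subst hX1 hX hG1 hG hN
  have hv : v1 = (-β*z*v - 2*w)/T := by field_simp; linarith
  have hw : w2 = (T*(-(β+2)*z*w1 + (m-β)*w) + 2*(-β*z*v - 2*w))/T^2 := by
    field_simp; linarith
  subst hv hw
  field_simp
  subst hT
  ring

lemma core (K v v1 v2 w w1 w2 : ℝ → ℝ) (hK : Continuous K) (hKi : Integrable K)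
    (m β : ℝ) (hm : 2 ≤ m) (hβ : 1 < β) (hmβ : β < m)
    (hv : ∀ z, HasDerivAt v (v1 z) z) (hv1 : ∀ z, HasDerivAt v1 (v2 z) z)
    (hw : ∀ z, HasDerivAt w (w1 z) z) (hw1 : ∀ z, HasDerivAt w1 (w2 z) z)
    (eq1 : ∀ z, (1+z^2) * v2 z + (β+2)*z*v1 z + β * v z + 2 * w1 z = 0)
    (eq2 : ∀ z, (1+z^2) * w2 z + (β+2)*z*w1 z - (m-β) * w z - 2 * v1 z = 0)
    (hb : ∀ z, (v z ^2 + w z ^2) * (1+z^2)^(β/2) ≤ K z) :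
    ∃ c : ℝ, ∀ z, v z = c * (((m-β)*z^2+(m+β)) * (1+z^2)^(-(β+2)/2)) ∧
      w z = c * (2*β*z*(1+z^2)^(-(β+2)/2)) := by
  have hTp : ∀ z : ℝ, 0 < 1 + z^2 := fun z => by positivity
  have hb0 : 0 < m - β := by linarith
  have hK0 : ∀ z, 0 ≤ K z := fun z => le_trans (by have := hTp z; positivity) (hb z)
  have hT' : ∀ z : ℝ, HasDerivAt (fun z : ℝ => 1 + z^2) (2*z) z := fun z =>
    ((hasDerivAt_pow 2 z).const_add 1).congr_deriv (by simp)
  -- first integral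
  have hC : ∀ z, (1+z^2) * v1 z + β * z * v z + 2 * w z = 0 := by
    have hd : ∀ z, HasDerivAt (fun z => (1+z^2) * v1 z + β * z * v z + 2 * w z) 0 z := fun z => by
      have := (((hT' z).mul (hv1 z)).add ((((hasDerivAt_id' z).const_mul β)).mul (hv z))).add
        ((hw z).const_mul 2)
      refine this.congr_deriv ?_
      linear_combination eq1 z
    have hcst : ∀ z, (1+z^2) * v1 z + β * z * v z + 2 * w z =
        (1+0^2) * v1 0 + β * 0 * v 0 + 2 * w 0 := fun z =>
      is_const_of_deriv_eq_zero (fun z => (hd z).differentiableAt) (fun z => (hd z).deriv) z 0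
    set C := (1+0^2) * v1 0 + β * 0 * v 0 + 2 * w 0 with hCdef
    have hb' : ∀ z, 1 ≤ z → z * (v z ^ 2 + w z ^2) ≤ K z := by
      intro z hz
      refine le_trans ?_ (hb z)
      rw [mul_comm]
      apply mul_le_mul_of_nonneg_left _ (by positivity)
      calc z = (z^2)^(1/2:ℝ) := by
            rw [← Real.sqrt_eq_rpow, Real.sqrt_sq (by linarith)]
        _ ≤ (1+z^2)^(1/2:ℝ) := Real.rpow_le_rpow (by positivity) (by linarith) (by norm_num)
        _ ≤ (1+z^2)^(β/2) := Real.rpow_le_rpow_of_exponent_le (by nlinarith) (by linarith)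
    have c1 := C_le K v v1 w hK hKi hK0 β C hβ hv hb' hcst
    have c2 := C_le K (fun z => -v z) (fun z => -v1 z) (fun z => -w z) hK hKi hK0 β (-C) hβ
      (fun z => (hv z).neg) (fun z hz => by simpa using hb' z hz)
      (fun z => by linear_combination -hcst z)
    intro z
    rw [hcst z]; linarith
  have hv1e : ∀ z, v1 z = (-β*z*v z - 2*w z)/(1+z^2) := fun z => by
    rw [eq_div_iff (hTp z).ne']; linarith [hC z]
  have hw2e : ∀ z, w2 z = (-(β+2)*z*w1 z + (m-β)*w z + 2*v1 z)/(1+z^2) := fun z => by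
    rw [eq_div_iff (hTp z).ne']; linarith [eq2 z]
  -- auxiliary functions
  let N : ℝ → ℝ := fun z => (m-β)*z^2 + (m+β)
  let P : ℝ → ℝ := fun z => (m-2)*z^2+m+2
  let G : ℝ → ℝ := fun z => ((m-2)*z^2+m+2)*N z + 8*β*z^2 + 4*β*m*(z+z^3)*Real.arctan z
  let G1 : ℝ → ℝ := fun z => 2*(m-2)*z*N z + ((m-2)*z^2+m+2)*(2*(m-β)*z) + 16*β*z
    + 4*β*m*((1+3*z^2)*Real.arctan z + z)
  let G2 : ℝ → ℝ := fun z => 2*(m-2)*N z + 2*(m-2)*z*(2*(m-β)*z) + 2*(m-2)*z*(2*(m-β)*z)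
      + ((m-2)*z^2+m+2)*(2*(m-β)) + 16*β + 4*β*m*(6*z*Real.arctan z + (1+3*z^2)/(1+z^2) + 1)
  let X : ℝ → ℝ := fun z => w z * N z - 2*β*z*v z
  let X1 : ℝ → ℝ := fun z => (1+z^2)*N z*w1 z + 2*(m-β)*z*(1+z^2)*w z - 2*β*(1+z^2)*v z
    + 2*β*z*(β*z*v z+2*w z)
  let X1d : ℝ → ℝ := fun z => 2*z*N z*w1 z + (1+z^2)*(2*(m-β)*z)*w1 z + (1+z^2)*N z*w2 z
      + 2*(m-β)*(1+3*z^2)*w z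
      + 2*(m-β)*z*(1+z^2)*w1 z - 4*β*z*v z - 2*β*(1+z^2)*v1 z
      + 2*β*(2*β*z*v z + β*z^2*v1 z + 2*w z + 2*z*w1 z)
  let S : ℝ → ℝ := fun z => G z*(X1 z+(β+2)*z*X z) - (1+z^2)*X z*G1 z
  let Sd : ℝ → ℝ := fun z => G1 z*(X1 z+(β+2)*z*X z)
    + G z*(X1d z+(β+2)*X z+(β+2)*z*(X1 z/(1+z^2))) - 2*z*X z*G1 z - X1 z*G1 z - (1+z^2)*X z*G2 z
  have hid : ∀ z, HasDerivAt (fun z : ℝ => z) 1 z := fun z => hasDerivAt_id' z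
  have hsq : ∀ z : ℝ, HasDerivAt (fun z : ℝ => z^2) (2*z) z := fun z =>
    (hasDerivAt_pow 2 z).congr_deriv (by simp)
  have hcu : ∀ z : ℝ, HasDerivAt (fun z : ℝ => z^3) (3*z^2) z := fun z =>
    (hasDerivAt_pow 3 z).congr_deriv (by simp)
  have hat : ∀ z : ℝ, HasDerivAt Real.arctan (1/(1+z^2)) z := Real.hasDerivAt_arctan
  have hN : ∀ z, HasDerivAt N (2*(m-β)*z) z := fun z =>
    (((hsq z).const_mul (m-β)).add_const (m+β)).congr_deriv (by ring)
  have hP : ∀ z, HasDerivAt P (2*(m-2)*z) z := fun z =>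
    ((((hsq z).const_mul (m-2)).add_const m).add_const 2).congr_deriv (by ring)
  have hNp : ∀ z, 0 < N z := fun z => by
    have : 0 ≤ (m-β)*z^2 := by positivity
    show 0 < (m-β)*z^2 + (m+β)
    linarith
  have hzat : ∀ z : ℝ, 0 ≤ z * Real.arctan z := fun z => by
    rcases le_total 0 z with h | h
    · exact mul_nonneg h (Real.arctan_nonneg.2 h)
    · exact mul_nonneg_of_nonpos_of_nonpos h (Real.arctan_le_zero.2 h)
  have hGp : ∀ z, 0 < G z := fun z => by
    have h1 : 0 < ((m-2)*z^2+m+2)*N z := by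
      apply mul_pos _ (hNp z)
      have : 0 ≤ (m-2)*z^2 := mul_nonneg (by linarith) (sq_nonneg z)
      linarith
    have h2 : 0 ≤ 8*β*z^2 := by positivity
    have h3 : 0 ≤ 4*β*m*(1+z^2)*(z*Real.arctan z) :=
      mul_nonneg (by have := hTp z; positivity) (hzat z)
    show 0 < ((m-2)*z^2+m+2)*N z + 8*β*z^2 + 4*β*m*(z+z^3)*Real.arctan z
    nlinarith
  have hG : ∀ z, HasDerivAt G (G1 z) z := fun z => by
    have := (((hP z).mul (hN z)).add ((hsq z).const_mul (8*β))).add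
      ((((hid z).add (hcu z)).const_mul (4*β*m)).mul (hat z))
    refine this.congr_deriv ?_
    have := (hTp z).ne'
    simp only [G1, P, Pi.add_apply]
    field_simp
    ring
  have hG1 : ∀ z, HasDerivAt G1 (G2 z) z := fun z => by
    have := (((((hid z).const_mul (2*(m-2))).mul (hN z)).add
      ((hP z).mul ((hid z).const_mul (2*(m-β))))).add ((hid z).const_mul (16*β))).add
      ((((((hsq z).const_mul 3).const_add 1).mul (hat z)).add (hid z)).const_mul (4*β*m))
    refine this.congr_deriv ?_
    have := (hTp z).ne'
    simp only [G2, P]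
    field_simp
    ring
  have hX : ∀ z, HasDerivAt X (X1 z/(1+z^2)) z := fun z => by
    have := ((hw z).mul (hN z)).sub (((hid z).const_mul (2*β)).mul (hv z))
    refine this.congr_deriv ?_
    have := (hTp z).ne'
    rw [hv1e z]
    simp only [X1]
    field_simp
    ring
  have hX1 : ∀ z, HasDerivAt X1 (X1d z) z := fun z => by
    have := (((((hT' z).mul (hN z)).mul (hw1 z)).add
      ((((hid z).const_mul (2*(m-β))).mul (hT' z)).mul (hw z))).sub
      (((hT' z).const_mul (2*β)).mul (hv z))).add
      (((hid z).const_mul (2*β)).mul ((((hid z).const_mul β).mul (hv z)).add ((hw z).const_mul 2)))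
    refine this.congr_deriv ?_
    simp only [X1d, Pi.mul_apply, Pi.add_apply]
    ring
  have hS : ∀ z, HasDerivAt S (Sd z) z := fun z => by
    have := ((hG z).mul ((hX1 z).add (((hid z).const_mul (β+2)).mul (hX z)))).sub
      (((hT' z).mul (hX z)).mul (hG1 z))
    refine this.congr_deriv ?_
    have := (hTp z).ne'
    simp only [Sd, Pi.mul_apply, Pi.add_apply]
    field_simp
    ring
  have hid2 : ∀ z, Sd z*(1+z^2)*N z - S z*(4*z*N z + 2*(m-β)*z*(1+z^2))
      = (1+z^2)*N z^2*(m*(m-2)*(1+z^2) + 4*m*β*z*Real.arctan z)*X z := fun z =>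
    alg_id m β z (Real.arctan z) (v z) (w z) (w1 z) (v1 z) (w2 z) (1+z^2) (N z) (G z) (G1 z) (G2 z)
      (X z) (X1 z) (X1d z) (S z) (Sd z) rfl (hTp z).ne' rfl rfl rfl rfl rfl rfl rfl rfl rfl
      (hv1e z) (hw2e z)
  let τ : ℝ → ℝ := fun z => (1+z^2)^((β+2)/2)
  have hτp : ∀ z, 0 < τ z := fun z => Real.rpow_pos_of_pos (hTp z) _
  have hτ : ∀ z, HasDerivAt τ ((β+2)*z/(1+z^2)*τ z) z := fun z =>
    (hd_rpow ((β+2)/2) z).congr_deriv (by simp only [τ]; ring)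
  have hτe : ∀ z, τ z = (1+z^2) * (1+z^2)^(β/2) := fun z => by
    simp only [τ]
    rw [show (β+2)/2 = 1 + β/2 by ring, Real.rpow_add (hTp z), Real.rpow_one]
  have hY0 := liou K (fun z => S z / ((1+z^2)^2*N z)) (fun z => τ z * X z / G z)
    (fun z => (m*(m-2)*(1+z^2) + 4*m*β*z*Real.arctan z) * G z / (τ z*(1+z^2)^2))
    (fun z => τ z * (1+z^2)*N z/G z^2) hK hKi hK0 (2*(m+β)+8*β^2/(m-β)) (by positivity)
    (fun z => by
      have hd := (hS z).div (((hT' z).pow 2).mul (hN z)) (by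
        have := hTp z; have := hNp z; simp only [Pi.mul_apply, Pi.pow_apply]; positivity)
      refine hd.congr_deriv ?_
      have h1 := (hTp z).ne'
      have h2 := (hNp z).ne'
      have h3 := (hGp z).ne'
      have h4 := (hτp z).ne'
      simp only [Pi.mul_apply, Pi.pow_apply]
      have h5 := hid2 z
      generalize hSS : S z = s at *
      generalize Sd z = sd at *
      generalize X z = x at *
      generalize G z = g at *
      generalize N z = nn at *
      generalize τ z = t at *
      generalize Real.arctan z = th at *
      field_simp
      norm_num
      linear_combination (1 + z^2) * h5)
    (fun z => by
      have hd := ((hτ z).mul (hX z)).div (hG z) (hGp z).ne'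
      refine hd.congr_deriv ?_
      have h1 := (hTp z).ne'
      have h2 := (hNp z).ne'
      have h3 := (hGp z).ne'
      simp only [Pi.mul_apply, S]
      generalize X z = x at *
      generalize X1 z = x1 at *
      generalize G z = g at *
      generalize G1 z = g1 at *
      generalize N z = nn at *
      generalize τ z = t at *
      field_simp
      ring)
    (fun z => by
      have h1 := hTp z
      have h2 := hGp z
      have h3 := hτp z
      have h4 : 0 ≤ m*(m-2)*(1+z^2) := mul_nonneg (mul_nonneg (by linarith) (by linarith)) h1.le
      have h5 : 0 ≤ 4*m*β*(z*Real.arctan z) := mul_nonneg (by positivity) (hzat z)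
      have h6 : 0 ≤ m*(m-2)*(1+z^2) + 4*m*β*z*Real.arctan z := by linarith
      positivity)
    (by
      have h2 := hGp 1
      have h3 := hτp 1
      have h4 : 0 ≤ m*(m-2) := mul_nonneg (by linarith) (by linarith)
      have h5 : 0 < Real.arctan 1 := Real.arctan_pos.2 one_pos
      have h6 : 0 < 4*m*β*Real.arctan 1 := by positivity
      have h7 : 0 < m*(m-2)*(1+1^2) + 4*m*β*1*Real.arctan 1 := by linarith
      positivity)
    (fun z => by
      have h1 := hTp z
      have h2 := hGp z
      have h3 := hτp z
      have h4 := hNp z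
      positivity)
    (fun z => by
      have h1 := hTp z
      have h2 := hGp z
      have h3 := hτp z
      have h4 := hNp z
      have h5 : X z^2 ≤ N z * ((1+z^2) * ((2*(m+β)+8*β^2/(m-β)) * (v z^2+w z^2))) := by
        have n1 : N z ≤ (m+β)*(1+z^2) := by simp only [N]; nlinarith
        have n2 : (m-β)*(1+z^2) ≤ N z := by simp only [N]; nlinarith
        have a1 : X z^2 ≤ 2*(w z * N z)^2 + 2*(2*β*z*v z)^2 := by
          simp only [X]; nlinarith [sq_nonneg (w z * N z + 2*β*z*v z)]
        have a2 : (w z * N z)^2 ≤ N z * ((m+β)*(1+z^2)) * w z^2 := by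
          nlinarith [mul_le_mul_of_nonneg_left n1 (mul_nonneg h4.le (sq_nonneg (w z)))]
        have a3 : 2*(2*β*z*v z)^2 ≤ N z * (1+z^2) * (8*β^2/(m-β)) * v z^2 := by
          have q1 : (m-β) * z^2 ≤ N z * (1+z^2) := by nlinarith [sq_nonneg z]
          have q2 : z^2 ≤ N z * (1+z^2) / (m-β) := by
            rw [le_div_iff₀ hb0]; linarith
          have := mul_le_mul_of_nonneg_left q2 (by positivity : 0 ≤ 8*β^2*v z^2)
          calc _ = 8*β^2*v z^2*z^2 := by ring
            _ ≤ _ := this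
            _ = _ := by ring
        have a4 : 0 ≤ N z * ((1+z^2) * (2*(m+β)*v z^2 + 8*β^2/(m-β)*w z^2)) := by positivity
        linarith
      have h6 : X z^2 * (1+z^2)^(β/2) ≤ N z * ((1+z^2) * ((2*(m+β)+8*β^2/(m-β)) * K z)) := by
        have hr : 0 ≤ (1+z^2)^(β/2) := by positivity
        calc _ ≤ _ := mul_le_mul_of_nonneg_right h5 hr
          _ = N z * ((1+z^2) * ((2*(m+β)+8*β^2/(m-β)) * ((v z^2+w z^2) * (1+z^2)^(β/2)))) := by ring
          _ ≤ _ := by gcongr; exact hb z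
      calc (τ z * X z / G z)^2 = τ z * (1+z^2) / G z^2 * (X z^2 * (1+z^2)^(β/2)) := by
            nth_rewrite 1 [div_pow, mul_pow, sq (τ z)]
            nth_rewrite 2 [hτe z]
            ring
        _ ≤ τ z * (1+z^2) / G z^2 * (N z * ((1+z^2) * ((2*(m+β)+8*β^2/(m-β)) * K z))) := by
            gcongr
        _ = _ := by ring)
  have hX0 : ∀ z, X z = 0 := fun z => by
    have := hY0 z
    simpa [(hτp z).ne', (hGp z).ne'] using this
  have hwe : ∀ z, w z = 2*β*z*v z / N z := fun z => by
    rw [eq_div_iff (hNp z).ne']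
    have := hX0 z
    simp only [X] at this
    linarith
  have hcd : ∀ z, HasDerivAt (fun z => v z * τ z / N z) 0 z := fun z => by
    have := ((hv z).mul (hτ z)).div (hN z) (hNp z).ne'
    refine this.congr_deriv ?_
    have h1 := (hTp z).ne'
    have h2 := (hNp z).ne'
    simp only [Pi.mul_apply]
    rw [hv1e z, hwe z]
    have h3 : N z = (m-β)*z^2 + (m+β) := rfl
    have : (-β * z * v z - 2 * (2 * β * z * v z / N z)) / (1 + z ^ 2) * τ z +
        v z * ((β + 2) * z / (1 + z ^ 2) * τ z) = v z * τ z * (2*(m-β)*z) / N z := by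
      field_simp
      rw [h3]; ring
    rw [this]
    field_simp
    ring
  have hcc := fun z => is_const_of_deriv_eq_zero (fun z => (hcd z).differentiableAt)
    (fun z => (hcd z).deriv) z 0
  have hve : ∀ z, v z = v 0 * τ 0 / N 0 * (N z * (1+z^2)^(-(β+2)/2)) := fun z => by
    have h1 := hcc z
    have h2 := (hNp z).ne'
    have h4 := (hτp z).ne'
    have h3 : (1+z^2)^(-(β+2)/2) = (τ z)⁻¹ := by
      rw [← Real.rpow_neg (hTp z).le]; congr 1; ring
    rw [h3, ← h1]
    field_simp
  refine ⟨v 0 * τ 0 / N 0, fun z => ⟨hve z, ?_⟩⟩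
  rw [hwe z, hve z]
  have h2 := (hNp z).ne'
  field_simp

lemma sol_deriv (m a : ℝ) (z : ℝ) :
    HasDerivAt (fun z : ℝ => ((m + a - 2) * z^2 + (m - a + 2)) * (1 + z^2) ^ ((a-4)/2))
      ((2*(m+a-2)*z + ((m + a - 2) * z^2 + (m - a + 2)) * ((a-4)*z/(1+z^2)))
        * (1 + z^2) ^ ((a-4)/2)) z := by
  have h1 := (((hasDerivAt_pow 2 z).const_mul (m+a-2)).add_const (m-a+2)).mul (hd_rpow ((a-4)/2) z)
  refine h1.congr_deriv ?_
  norm_num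
  ring

lemma sol_deriv2 (m a : ℝ) (z : ℝ) :
    HasDerivAt (fun z : ℝ => (2*(m+a-2)*z + ((m + a - 2) * z^2 + (m - a + 2)) * ((a-4)*z/(1+z^2)))
        * (1 + z^2) ^ ((a-4)/2))
      ((2*(m+a-2) + 2*(m+a-2)*z*((a-4)*z/(1+z^2))
        + ((m + a - 2) * z^2 + (m - a + 2)) * ((a-4)*(1-z^2)/(1+z^2)^2)
        + (2*(m+a-2)*z + ((m + a - 2) * z^2 + (m - a + 2)) * ((a-4)*z/(1+z^2)))
          * ((a-4)*z/(1+z^2)))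
        * (1 + z^2) ^ ((a-4)/2)) z := by
  have hT : (1 + z^2) ≠ 0 := by positivity
  have h0 : HasDerivAt (fun z : ℝ => 1 + z^2) (2*z) z :=
    ((hasDerivAt_pow 2 z).const_add 1).congr_deriv (by simp)
  have h1 := ((((hasDerivAt_id' z).const_mul (2*(m+a-2))).add
    ((((hasDerivAt_pow 2 z).const_mul (m+a-2)).add_const (m-a+2)).mul
      (((hasDerivAt_id' z).const_mul (a-4)).div h0 hT))).mul (hd_rpow ((a-4)/2) z))
  refine h1.congr_deriv ?_
  simp only [Pi.add_apply, Pi.mul_apply, Pi.div_apply]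
  norm_num
  field_simp
  ring

lemma sol_deriv_w (a : ℝ) (z : ℝ) :
    HasDerivAt (fun z : ℝ => 2 * (2 - a) * z * (1 + z^2) ^ ((a-4)/2))
      ((2*(2-a) + 2*(2-a)*z * ((a-4)*z/(1+z^2))) * (1 + z^2) ^ ((a-4)/2)) z := by
  have h1 := ((hasDerivAt_id' z).const_mul (2*(2-a))).mul (hd_rpow ((a-4)/2) z)
  refine h1.congr_deriv ?_
  ring

lemma sol_deriv_w2 (a : ℝ) (z : ℝ) :
    HasDerivAt (fun z : ℝ => (2*(2-a) + 2*(2-a)*z * ((a-4)*z/(1+z^2))) * (1 + z^2) ^ ((a-4)/2))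
      ((2*(2-a)*((a-4)*z/(1+z^2)) + 2*(2-a)*z*((a-4)*(1-z^2)/(1+z^2)^2)
        + (2*(2-a) + 2*(2-a)*z * ((a-4)*z/(1+z^2))) * ((a-4)*z/(1+z^2)))
        * (1 + z^2) ^ ((a-4)/2)) z := by
  have hT : (1 + z^2) ≠ 0 := by positivity
  have h0 : HasDerivAt (fun z : ℝ => 1 + z^2) (2*z) z :=
    ((hasDerivAt_pow 2 z).const_add 1).congr_deriv (by simp)
  have h1 := (((((hasDerivAt_id' z).const_mul (2*(2-a))).mul
      (((hasDerivAt_id' z).const_mul (a-4)).div h0 hT)).const_add (2*(2-a))).mul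
        (hd_rpow ((a-4)/2) z))
  refine h1.congr_deriv ?_
  simp only [Pi.mul_apply, Pi.div_apply]
  norm_num
  field_simp
  ring

lemma deriv_ofReal_fun (f f' : ℝ → ℝ) (h : ∀ z, HasDerivAt f (f' z) z) :
    deriv (fun z => ((f z : ℝ) : ℂ)) = fun z => ((f' z : ℝ) : ℂ) :=
  funext fun z => (h z).ofReal_comp.deriv

/-- for n ≥ 2, 0 ≤ p ≤ n/2 and 2-n+2p < a < 1; the pair (v₀,w₀) given by
v₀(z) = [(n-2p+a-2)z² + (n-2p-a+2)](1+z²)^{(a-4)/2}, w₀(z) = 2(2-a)z(1+z²)^{(a-4)/2}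
solves the coupled system
(1+z²)v'' - (a-4)z v' - (a-2)v + 2w' = 0, (1+z²)w'' - (a-4)z w' - (n-2p+a-2)w - 2v' = 0
with ∫(|v₀|²+|w₀|²)(1+z²)^{(2-a)/2} < ∞, and every C² solution pair with this
integrability is a scalar multiple of (v₀, w₀). -/
theorem stmt17 (n p : ℕ) (hn : 2 ≤ n) (hp : 2*p ≤ n)
    (a : ℝ) (ha1 : 2 - (n:ℝ) + 2*p < a) (ha2 : a < 1) :
    (∀ z : ℝ,
      ((1 + z^2 : ℝ) : ℂ) * deriv (deriv (v0 n p a)) z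
        - (((a - 4) * z : ℝ) : ℂ) * deriv (v0 n p a) z
        - ((a - 2 : ℝ) : ℂ) * v0 n p a z + 2 * deriv (w0 a) z = 0) ∧
    (∀ z : ℝ,
      ((1 + z^2 : ℝ) : ℂ) * deriv (deriv (w0 a)) z
        - (((a - 4) * z : ℝ) : ℂ) * deriv (w0 a) z
        - ((((n:ℝ) - 2*p + a - 2) : ℝ) : ℂ) * w0 a z - 2 * deriv (v0 n p a) z = 0) ∧
    Integrable (fun z : ℝ =>
      (‖v0 n p a z‖^2 + ‖w0 a z‖^2) * ((1 + z^2) ^ ((2-a)/2) : ℝ)) ∧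
    (∀ v w : ℝ → ℂ, ContDiff ℝ 2 v → ContDiff ℝ 2 w →
      (∀ z : ℝ,
        ((1 + z^2 : ℝ) : ℂ) * deriv (deriv v) z
          - (((a - 4) * z : ℝ) : ℂ) * deriv v z
          - ((a - 2 : ℝ) : ℂ) * v z + 2 * deriv w z = 0) →
      (∀ z : ℝ,
        ((1 + z^2 : ℝ) : ℂ) * deriv (deriv w) z
          - (((a - 4) * z : ℝ) : ℂ) * deriv w z
          - ((((n:ℝ) - 2*p + a - 2) : ℝ) : ℂ) * w z - 2 * deriv v z = 0) →
      Integrable (fun z : ℝ => ‖v z‖^2 * ((1 + z^2) ^ ((2-a)/2) : ℝ)) →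
      Integrable (fun z : ℝ => ‖w z‖^2 * ((1 + z^2) ^ ((2-a)/2) : ℝ)) →
      ∃ c : ℂ, (∀ z : ℝ, v z = c * v0 n p a z) ∧ (∀ z : ℝ, w z = c * w0 a z)) := by
  set m : ℝ := (n:ℝ) - 2*p with hmdef
  have hm : 2 ≤ m := by
    have h1 : (1:ℝ) < (n:ℝ) - 2*p := by linarith
    have h2 : 2*p + 1 < n := by
      have : ((2*p+1 : ℕ):ℝ) < (n:ℝ) := by push_cast; linarith
      exact_mod_cast this
    have : ((2*p+2 : ℕ):ℝ) ≤ (n:ℝ) := by exact_mod_cast h2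
    push_cast at this
    linarith
  have dv : deriv (v0 n p a) = _ := deriv_ofReal_fun _ _ (sol_deriv m a)
  have dv2 := deriv_ofReal_fun _ _ (sol_deriv2 m a)
  have dw : deriv (w0 a) = _ := deriv_ofReal_fun _ _ (sol_deriv_w a)
  have dw2 := deriv_ofReal_fun _ _ (sol_deriv_w2 a)
  refine ⟨?_, ?_, ?_, ?_⟩
  · intro z
    have hT : (1 + z^2) ≠ 0 := by positivity
    rw [dv, dv2, dw]
    simp only [v0]
    rw [← hmdef]
    norm_cast
    generalize (1+z^2)^((a-4)/2) = s
    field_simp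
    ring
  · intro z
    have hT : (1 + z^2) ≠ 0 := by positivity
    rw [dw, dw2, dv]
    simp only [w0]
    norm_cast
    generalize (1+z^2)^((a-4)/2) = s
    field_simp
    ring
  · have hi : Integrable (fun z : ℝ => (1 + z^2) ^ (-(2-a)/2)) := by
      have := integrable_rpow_neg_one_add_norm_sq (E := ℝ) (μ := volume) (r := 2-a)
        (by simp; linarith)
      simpa using this
    have he : (fun z : ℝ => (‖v0 n p a z‖^2 + ‖w0 a z‖^2) * ((1 + z^2) ^ ((2-a)/2) : ℝ)) =
        fun z : ℝ => ((((m + a - 2) * z^2 + (m - a + 2))^2 + (2*(2-a)*z)^2) / (1+z^2)^2) *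
          (1 + z^2) ^ (-(2-a)/2) := by
      funext z
      have hT : 0 < (1 + z^2) := by positivity
      simp only [v0, w0, Complex.norm_real, Real.norm_eq_abs, sq_abs]
      rw [← hmdef, mul_pow, mul_pow (2*(2-a)*z), ← add_mul, mul_assoc, div_mul_eq_mul_div,
        mul_div_assoc]
      congr 1
      rw [← Real.rpow_natCast (_ ^ _), ← Real.rpow_mul hT.le, ← Real.rpow_add hT,
        ← Real.rpow_natCast (1+z^2) 2, ← Real.rpow_sub hT]
      congr 1
      push_cast
      ring
    rw [he]
    refine hi.bdd_mul (c := (|m+a-2| + |m-a+2|)^2 + (2*(2-a))^2) ?_ ?_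
    · apply Continuous.aestronglyMeasurable
      apply Continuous.div (by fun_prop) (by fun_prop)
      intro z; positivity
    · refine Filter.Eventually.of_forall fun z => ?_
      have hT : 0 < (1 + z^2) := by positivity
      rw [Real.norm_eq_abs, abs_of_nonneg (by positivity), div_le_iff₀ (by positivity), add_mul]
      apply add_le_add
      · rw [← mul_pow, ← sq_abs ((m + a - 2) * z^2 + (m - a + 2))]
        apply pow_le_pow_left₀ (abs_nonneg _)
        refine (abs_add_le _ _).trans ?_
        rw [abs_mul, abs_of_nonneg (sq_nonneg z)]
        nlinarith [abs_nonneg (m+a-2), abs_nonneg (m-a+2), sq_nonneg z,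
          mul_nonneg (abs_nonneg (m-a+2)) (sq_nonneg z)]
      · rw [mul_pow]
        apply mul_le_mul_of_nonneg_left _ (sq_nonneg _)
        nlinarith [sq_nonneg z]
  · intro v w hv hw e1 e2 i1 i2
    have hd : ∀ f : ℝ → ℂ, ContDiff ℝ 2 f → (∀ z, HasDerivAt f (deriv f z) z) ∧
        (∀ z, HasDerivAt (deriv f) (deriv (deriv f) z) z) := fun f hf => by
      have h1 : ContDiff ℝ 1 (deriv f) := by
        have : ContDiff ℝ (1+1) f := by simpa [one_add_one_eq_two] using hf
        exact (contDiff_succ_iff_deriv.1 this).2.2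
      exact ⟨fun z => (hf.differentiable (by norm_num) z).hasDerivAt,
        fun z => (h1.differentiable (by norm_num) z).hasDerivAt⟩
    obtain ⟨hv1, hv2⟩ := hd v hv
    obtain ⟨hw1, hw2⟩ := hd w hw
    have hre : ∀ (f : ℝ → ℂ) (f' : ℂ) (z : ℝ), HasDerivAt f f' z →
        HasDerivAt (fun z => (f z).re) f'.re z := fun f f' z h =>
      Complex.reCLM.hasFDerivAt.comp_hasDerivAt z h
    have him : ∀ (f : ℝ → ℂ) (f' : ℂ) (z : ℝ), HasDerivAt f f' z →
        HasDerivAt (fun z => (f z).im) f'.im z := fun f f' z h =>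
      Complex.imCLM.hasFDerivAt.comp_hasDerivAt z h
    have hKi := i1.add i2
    have hKc : Continuous ((fun z : ℝ => ‖v z‖^2 * ((1 + z^2) ^ ((2-a)/2) : ℝ)) +
        (fun z : ℝ => ‖w z‖^2 * ((1 + z^2) ^ ((2-a)/2) : ℝ))) := by
      have := hv.continuous
      have := hw.continuous
      have hr : Continuous (fun z : ℝ => ((1 + z^2) ^ ((2-a)/2) : ℝ)) :=
        Continuous.rpow_const (by fun_prop) (fun z => Or.inl (by positivity))
      exact ((by fun_prop : Continuous (fun z => ‖v z‖^2)).mul hr).add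
        ((by fun_prop : Continuous (fun z => ‖w z‖^2)).mul hr)
    have hexp : -((2 - a) + 2) / 2 = (a-4)/2 := by ring
    obtain ⟨c1, h1⟩ := core _ (fun z => (v z).re) (fun z => (deriv v z).re)
      (fun z => (deriv (deriv v) z).re) (fun z => (w z).re) (fun z => (deriv w z).re)
      (fun z => (deriv (deriv w) z).re) hKc hKi m (2-a) hm (by linarith) (by linarith)
      (fun z => hre _ _ z (hv1 z)) (fun z => hre _ _ z (hv2 z))
      (fun z => hre _ _ z (hw1 z)) (fun z => hre _ _ z (hw2 z))
      (fun z => by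
        have := congrArg Complex.re (e1 z)
        simp only [Complex.add_re, Complex.sub_re, Complex.re_ofReal_mul, Complex.zero_re,
          Complex.re_ofNat, Complex.im_ofNat, Complex.mul_re, Complex.ofReal_re, Complex.ofReal_im] at this
        linarith)
      (fun z => by
        have := congrArg Complex.re (e2 z)
        simp only [Complex.add_re, Complex.sub_re, Complex.re_ofReal_mul, Complex.zero_re,
          Complex.re_ofNat, Complex.im_ofNat, Complex.mul_re, Complex.ofReal_re, Complex.ofReal_im] at this
        linarith)
      (fun z => by
        rw [Pi.add_apply, ← add_mul]
        refine mul_le_mul_of_nonneg_right (add_le_add ?_ ?_) (by positivity)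
        · rw [← sq_abs]; exact pow_le_pow_left₀ (abs_nonneg _) (Complex.abs_re_le_norm _) 2
        · rw [← sq_abs]; exact pow_le_pow_left₀ (abs_nonneg _) (Complex.abs_re_le_norm _) 2)
    obtain ⟨c2, h2⟩ := core _ (fun z => (v z).im) (fun z => (deriv v z).im)
      (fun z => (deriv (deriv v) z).im) (fun z => (w z).im) (fun z => (deriv w z).im)
      (fun z => (deriv (deriv w) z).im) hKc hKi m (2-a) hm (by linarith) (by linarith)
      (fun z => him _ _ z (hv1 z)) (fun z => him _ _ z (hv2 z))
      (fun z => him _ _ z (hw1 z)) (fun z => him _ _ z (hw2 z))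
      (fun z => by
        have := congrArg Complex.im (e1 z)
        simp only [Complex.add_im, Complex.sub_im, Complex.zero_im,
          Complex.re_ofNat, Complex.im_ofNat, Complex.mul_im, Complex.ofReal_re, Complex.ofReal_im] at this
        linarith)
      (fun z => by
        have := congrArg Complex.im (e2 z)
        simp only [Complex.add_im, Complex.sub_im, Complex.zero_im,
          Complex.re_ofNat, Complex.im_ofNat, Complex.mul_im, Complex.ofReal_re, Complex.ofReal_im] at this
        linarith)
      (fun z => by
        rw [Pi.add_apply, ← add_mul]
        refine mul_le_mul_of_nonneg_right (add_le_add ?_ ?_) (by positivity)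
        · rw [← sq_abs]; exact pow_le_pow_left₀ (abs_nonneg _) (Complex.abs_im_le_norm _) 2
        · rw [← sq_abs]; exact pow_le_pow_left₀ (abs_nonneg _) (Complex.abs_im_le_norm _) 2)
    rw [hexp] at h1 h2
    refine ⟨⟨c1, c2⟩, fun z => ?_, fun z => ?_⟩
    · have hvz : v0 n p a z = (((((m-(2-a))*z^2+(m+(2-a))) * (1+z^2)^((a-4)/2) : ℝ)) : ℂ) := by
        simp only [v0]; rw [← hmdef]; congr 1; ring
      rw [hvz]
      apply Complex.ext
      · rw [Complex.re_mul_ofReal]; exact (h1 z).1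
      · rw [Complex.im_mul_ofReal]; exact (h2 z).1
    · simp only [w0]
      apply Complex.ext
      · rw [Complex.re_mul_ofReal]; exact (h1 z).2
      · rw [Complex.im_mul_ofReal]; exact (h2 z).2

end
end
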